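/- In ℝ², the integral of the breadth function u ↦ b_u(K) over the unit circle S¹ equals twice the perimeter of the compact convex set K. -/

import Mathlib

open MeasureTheory
open scoped RealInnerProductSpace

/-- The support function of a plane set. -/
noncomputable def suppFn (K : Set (EuclideanSpace ℝ (Fin 2)))
    (u : EuclideanSpace ℝ (Fin 2)) : ℝ :=
  sSup ((fun x => ⟪x, u⟫) '' K)

/-- The breadth of `K` in direction `u`. -/
noncomputable def breadth (K : Set (EuclideanSpace ℝ (Fin 2)))
    (u : EuclideanSpace ℝ (Fin 2)) : ℝ :=
  suppFn K u + suppFn K (-u)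

/-- The unit vector at angle `θ`. -/
noncomputable def dir (θ : ℝ) : EuclideanSpace ℝ (Fin 2) :=
  (WithLp.equiv 2 (Fin 2 → ℝ)).symm ![Real.cos θ, Real.sin θ]


/-- Abbreviation for the Euclidean plane. -/
abbrev Pl := EuclideanSpace ℝ (Fin 2)

lemma inner_coord (x y : Pl) : ⟪x, y⟫ = x 0 * y 0 + x 1 * y 1 := by
  simp [PiLp.inner_apply, Fin.sum_univ_two, mul_comm]

lemma dir_zero (θ : ℝ) : dir θ 0 = Real.cos θ := by simp [dir]
lemma dir_one (θ : ℝ) : dir θ 1 = Real.sin θ := by simp [dir]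

lemma norm_sq_coord (x : Pl) : ‖x‖ ^ 2 = x 0 ^ 2 + x 1 ^ 2 := by
  simp [EuclideanSpace.norm_sq_eq, Fin.sum_univ_two]

lemma norm_dir (θ : ℝ) : ‖dir θ‖ = 1 := by
  have h := norm_sq_coord (dir θ)
  rw [dir_zero, dir_one, Real.cos_sq_add_sin_sq] at h
  have := norm_nonneg (dir θ)
  nlinarith

lemma continuous_dir : Continuous dir := by
  unfold dir
  apply (PiLp.continuous_toLp 2 _).comp
  refine continuous_pi ?_
  intro i
  fin_cases i
  · exact Real.continuous_cos
  · exact Real.continuous_sin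

lemma norm_dir_sub (a b : ℝ) : ‖dir a - dir b‖ ≤ 2 * |a - b| := by
  have h := norm_sq_coord (dir a - dir b)
  simp only [PiLp.sub_apply, dir_zero, dir_one] at h
  have h1 := Real.abs_cos_sub_cos_le a b
  have h2 := Real.abs_sin_sub_sin_le a b
  have h3 := sq_le_sq.2 (h1.trans (le_abs_self _))
  have h4 := sq_le_sq.2 (h2.trans (le_abs_self _))
  apply abs_le_of_sq_le_sq' _ (by positivity) |>.2
  rw [h]; nlinarith [sq_nonneg |a - b|]

lemma exists_dir (n : Pl) (hn : ‖n‖ = 1) : ∃ θ ∈ Set.Icc (0:ℝ) (2 * Real.pi), dir θ = n := by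
  have h := norm_sq_coord n
  rw [hn] at h
  set z : ℂ := ⟨n 0, n 1⟩ with hz
  have hz1 : ‖z‖ = 1 := by
    have : ‖z‖ ^ 2 = 1 := by rw [← Complex.normSq_eq_norm_sq, Complex.normSq_apply]; simp [hz]; linarith
    have := norm_nonneg z
    nlinarith
  have hc : Real.cos z.arg = n 0 := by
    have := Complex.norm_mul_cos_arg z
    rw [hz1, one_mul] at this; rw [this]
  have hs : Real.sin z.arg = n 1 := by
    have := Complex.norm_mul_sin_arg z
    rw [hz1, one_mul] at this; rw [this]
  have e1 := Complex.arg_le_pi z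
  have e2 := Complex.neg_pi_lt_arg z
  have hp := Real.pi_pos
  by_cases h0 : 0 ≤ z.arg
  · refine ⟨z.arg, ⟨h0, by linarith⟩, ?_⟩
    ext i; fin_cases i
    · simpa [dir_zero] using hc
    · simpa [dir_one] using hs
  · refine ⟨z.arg + 2 * Real.pi, ⟨by linarith, by linarith⟩, ?_⟩
    ext i; fin_cases i
    · simpa [dir_zero] using hc
    · simpa [dir_one] using hs

/-- decomposition bounds for `⟪w, dir θ⟫` when `w` is nearly orthogonal to `dir φ`. -/
lemma inner_bounds {w : Pl} {φ η : ℝ} (hw : |⟪w, dir φ⟫| ≤ η * ‖w‖) (θ : ℝ) :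
    |⟪w, dir θ⟫| ≤ (|Real.sin (θ - φ)| + η) * ‖w‖ ∧
    (|Real.sin (θ - φ)| - 2 * η) * ‖w‖ ≤ |⟪w, dir θ⟫| := by
  set a := -w 0 * Real.sin φ + w 1 * Real.cos φ with ha
  set b := ⟪w, dir φ⟫ with hb
  have hb' : b = w 0 * Real.cos φ + w 1 * Real.sin φ := by
    rw [hb, inner_coord, dir_zero, dir_one]
  have hsq : ‖w‖ ^ 2 = a ^ 2 + b ^ 2 := by
    rw [norm_sq_coord, ha, hb']
    linear_combination (- (w 0) ^ 2 - (w 1) ^ 2) * Real.sin_sq_add_cos_sq φ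
  have hdec : ⟪w, dir θ⟫ = a * Real.sin (θ - φ) + b * Real.cos (θ - φ) := by
    rw [inner_coord, dir_zero, dir_one, ha, hb', Real.sin_sub, Real.cos_sub]
    linear_combination (- (w 0) * Real.cos θ - w 1 * Real.sin θ) * Real.sin_sq_add_cos_sq φ
  have hN := norm_nonneg w
  have haN : |a| ≤ ‖w‖ := by
    apply abs_le_of_sq_le_sq _ hN
    nlinarith [sq_nonneg b]
  have hNab : ‖w‖ ≤ |a| + |b| := by
    apply abs_le_of_sq_le_sq' _ (by positivity) |>.2
    rw [hsq, ← sq_abs a, ← sq_abs b]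
    nlinarith [mul_nonneg (abs_nonneg a) (abs_nonneg b)]
  have hs1 := Real.abs_sin_le_one (θ - φ)
  have hc1 := Real.abs_cos_le_one (θ - φ)
  have hs0 := abs_nonneg (Real.sin (θ - φ))
  have hbc : |b * Real.cos (θ - φ)| ≤ η * ‖w‖ := by
    rw [abs_mul]
    nlinarith [abs_nonneg b]
  have has : |a * Real.sin (θ - φ)| = |a| * |Real.sin (θ - φ)| := abs_mul _ _
  rw [hdec]
  constructor
  · refine (abs_add_le _ _).trans ?_
    rw [has]; nlinarith
  · have := abs_sub_abs_le_abs_sub (a * Real.sin (θ - φ)) (-(b * Real.cos (θ - φ)))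
    rw [abs_neg, sub_neg_eq_add] at this
    refine le_trans ?_ this
    rw [has]; nlinarith [abs_nonneg b]

lemma integral_abs_sin (φ : ℝ) : ∫ θ in (0:ℝ)..(2 * Real.pi), |Real.sin (θ - φ)| = 4 := by
  have hper : Function.Periodic (fun x => |Real.sin x|) (2 * Real.pi) := by
    intro x; simp
  have hpi := Real.pi_pos
  rw [intervalIntegral.integral_comp_sub_right (fun x => |Real.sin x|) φ]
  have h := hper.intervalIntegral_add_eq (0 - φ) 0
  rw [show 0 - φ + 2 * Real.pi = 2 * Real.pi - φ by ring, zero_add] at h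
  rw [h]
  have hintg : ∀ a b : ℝ, IntervalIntegrable (fun x => |Real.sin x|) volume a b := fun a b =>
    (Real.continuous_sin.abs).intervalIntegrable a b
  rw [← intervalIntegral.integral_add_adjacent_intervals (hintg 0 Real.pi) (hintg _ _)]
  have e1 : ∫ x in (0:ℝ)..Real.pi, |Real.sin x| = ∫ x in (0:ℝ)..Real.pi, Real.sin x := by
    apply intervalIntegral.integral_congr
    intro x hx
    rw [Set.uIcc_of_le hpi.le] at hx
    exact abs_of_nonneg (Real.sin_nonneg_of_mem_Icc hx)
  have e2 : ∫ x in Real.pi..(2 * Real.pi), |Real.sin x| =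
      ∫ x in Real.pi..(2 * Real.pi), -Real.sin x := by
    apply intervalIntegral.integral_congr
    intro x hx
    rw [Set.uIcc_of_le (by linarith)] at hx
    apply abs_of_nonpos
    have := Real.sin_nonneg_of_nonneg_of_le_pi (x := x - Real.pi) (by linarith [hx.1]) (by linarith [hx.2])
    rw [Real.sin_sub_pi] at this
    linarith
  rw [e1, e2, intervalIntegral.integral_neg, integral_sin, integral_sin]
  simp
  norm_num

lemma volume_image_le {P : Set Pl} {f : Pl → ℝ} {k : ℝ} (hk : 0 ≤ k)
    (h : ∀ x ∈ P, ∀ y ∈ P, |f x - f y| ≤ k * ‖x - y‖) :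
    volume (f '' P) ≤ ENNReal.ofReal k * μH[1] P := by
  have hl : LipschitzOnWith k.toNNReal f P := by
    apply LipschitzOnWith.of_dist_le_mul
    intro x hx y hy
    rw [Real.dist_eq, dist_eq_norm, Real.coe_toNNReal k hk]
    exact h x hx y hy
  have := hl.hausdorffMeasure_image_le (d := 1) zero_le_one
  rw [hausdorffMeasure_real] at this
  simpa [ENNReal.ofReal] using this

lemma le_volume_image {P : Set Pl} {f : Pl → ℝ} {k : ℝ} (hk : 0 < k)
    (h : ∀ x ∈ P, ∀ y ∈ P, k * ‖x - y‖ ≤ |f x - f y|) :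
    ENNReal.ofReal k * μH[1] P ≤ volume (f '' P) := by
  have hinj : Set.InjOn f P := by
    intro x hx y hy hxy
    have := h x hx y hy
    rw [hxy, sub_self, abs_zero] at this
    have h2 : ‖x - y‖ ≤ 0 := by
      by_contra hc
      push Not at hc
      nlinarith [mul_pos hk hc]
    exact sub_eq_zero.1 (norm_le_zero_iff.1 h2)
  set g := Function.invFunOn f P
  have hg : ∀ x ∈ P, g (f x) = x := fun x hx => hinj.leftInvOn_invFunOn hx
  have hl : LipschitzOnWith (k⁻¹).toNNReal g (f '' P) := by
    apply LipschitzOnWith.of_dist_le_mul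
    rintro _ ⟨x, hx, rfl⟩ _ ⟨y, hy, rfl⟩
    rw [hg x hx, hg y hy, Real.dist_eq, dist_eq_norm, Real.coe_toNNReal _ (by positivity)]
    rw [inv_mul_eq_div, le_div_iff₀ hk, mul_comm]
    exact h x hx y hy
  have := hl.hausdorffMeasure_image_le (d := 1) zero_le_one
  have himg : g '' (f '' P) = P := by
    rw [Set.image_image]
    ext x
    constructor
    · rintro ⟨y, hy, rfl⟩; simpa only [hg y hy] using hy
    · intro hx; exact ⟨x, hx, hg x hx⟩
  rw [hausdorffMeasure_real, himg] at this
  calc ENNReal.ofReal k * μH[1] P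
      ≤ ENNReal.ofReal k * (ENNReal.ofReal k⁻¹ * volume (f '' P)) := by
        gcongr
        simpa [ENNReal.ofReal] using this
    _ = volume (f '' P) := by
        rw [← mul_assoc, ← ENNReal.ofReal_mul hk.le, mul_inv_cancel₀ hk.ne']
        simp

lemma exists_normal {K : Set Pl} (hKv : Convex ℝ K) (hKi : (interior K).Nonempty)
    {x : Pl} (hx : x ∈ frontier K) :
    ∃ θ ∈ Set.Icc (0:ℝ) (2 * Real.pi), ∀ y ∈ K, ⟪y - x, dir θ⟫ ≤ 0 := by
  obtain ⟨f, hf0, hf⟩ := geometric_hahn_banach_of_nonempty_interior_point hKv hx.2 hKi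
  set n := (InnerProductSpace.toDual ℝ Pl).symm f with hn
  have hfn : ∀ y, f y = ⟪n, y⟫ := by
    intro y
    rw [hn, InnerProductSpace.toDual_symm_apply]
  have hn0 : n ≠ 0 := by
    rw [hn]; simpa using hf0
  have hnn : 0 < ‖n‖ := norm_pos_iff.2 hn0
  obtain ⟨θ, hθ, hd⟩ := exists_dir (‖n‖⁻¹ • n) (by rw [norm_smul, norm_inv, norm_norm]; field_simp)
  refine ⟨θ, hθ, fun y hy => ?_⟩
  rw [hd, inner_smul_right, real_inner_comm, inner_sub_right, ← hfn, ← hfn]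
  have := hf y hy
  have h2 : 0 < ‖n‖⁻¹ := by positivity
  nlinarith

lemma suppFn_max {K : Set Pl} (hK : K.Nonempty) (hKc : IsCompact K) (u : Pl) :
    (∃ x ∈ K, ⟪x, u⟫ = suppFn K u) ∧ ∀ x ∈ K, ⟪x, u⟫ ≤ suppFn K u := by
  have hc : ContinuousOn (fun x : Pl => ⟪x, u⟫) K := by fun_prop
  obtain ⟨x, hx, h1, h2⟩ := hKc.exists_sSup_image_eq_and_ge hK hc
  refine ⟨⟨x, hx, h1.symm⟩, fun y hy => ?_⟩
  unfold suppFn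
  rw [h1]; exact h2 y hy

/-- points strictly between the extreme values are attained in the interior -/
lemma exists_interior_level {K : Set Pl} (hK : K.Nonempty) (hKc : IsCompact K)
    (hKv : Convex ℝ K) (hKi : (interior K).Nonempty) (u : Pl) {t : ℝ}
    (ht : t ∈ Set.Ioo (-suppFn K (-u)) (suppFn K u)) :
    ∃ z ∈ interior K, ⟪z, u⟫ = t := by
  obtain ⟨p, hp⟩ := hKi
  obtain ⟨⟨x, hx, hxe⟩, -⟩ := suppFn_max hK hKc u
  obtain ⟨⟨y, hy, hye⟩, -⟩ := suppFn_max hK hKc (-u)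
  rw [inner_neg_right] at hye
  have key : ∀ q ∈ K, ∀ s : ℝ, 0 < s → s < 1 → p + s • (q - p) ∈ interior K := by
    intro q hq s h0 h1
    apply hKv.openSegment_interior_self_subset_interior hp hq
    refine ⟨1 - s, s, by linarith, h0, by ring, ?_⟩
    module
  have hval : ∀ q : Pl, ∀ s : ℝ, ⟪p + s • (q - p), u⟫ = ⟪p, u⟫ + s * (⟪q, u⟫ - ⟪p, u⟫) := by
    intro q s
    rw [inner_add_left, real_inner_smul_left, inner_sub_left]
  rcases lt_trichotomy t ⟪p, u⟫ with h | h | h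
  · have hd : ⟪y, u⟫ - ⟪p, u⟫ < 0 := by linarith [ht.1]
    refine ⟨_, key y hy ((t - ⟪p, u⟫) / (⟪y, u⟫ - ⟪p, u⟫)) (div_pos_of_neg_of_neg (by linarith) hd)
      ((div_lt_one_of_neg hd).2 (by linarith [ht.1])), ?_⟩
    rw [hval, div_mul_cancel₀ _ hd.ne]; ring
  · exact ⟨p, hp, h.symm⟩
  · have hd : 0 < ⟪x, u⟫ - ⟪p, u⟫ := by linarith [ht.2]
    refine ⟨_, key x hx ((t - ⟪p, u⟫) / (⟪x, u⟫ - ⟪p, u⟫)) (div_pos (by linarith) hd)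
      ((div_lt_one hd).2 (by linarith [ht.2])), ?_⟩
    rw [hval, div_mul_cancel₀ _ hd.ne']; ring

lemma exists_ray {K : Set Pl} (hKc : IsCompact K) {z v : Pl} (hz : z ∈ interior K)
    (hv : ‖v‖ = 1) : ∃ s : ℝ, s > 0 ∧ z + s • v ∈ frontier K := by
  have hcont : Continuous (fun s : ℝ => z + s • v) := by fun_prop
  have hpre : IsPreconnected ((fun s : ℝ => z + s • v) '' Set.Ici 0) :=
    isPreconnected_Ici.image _ hcont.continuousOn
  by_contra hcon
  push Not at hcon
  have hsub : (fun s : ℝ => z + s • v) '' Set.Ici 0 ⊆ interior K := by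
    apply hpre.subset_left_of_subset_union isOpen_interior
      (hKc.isClosed.isOpen_compl) (disjoint_compl_right.mono_left interior_subset)
    · rintro _ ⟨s, hs, rfl⟩
      by_contra hne
      rw [Set.mem_union, not_or, Set.notMem_compl_iff] at hne
      rcases (Set.mem_Ici.1 hs).eq_or_lt with h | h
      · apply hne.1; simpa [← h] using hz
      · exact hcon s h ⟨subset_closure hne.2, hne.1⟩
    · exact ⟨z, ⟨0, by simp, by simp⟩, hz⟩
  obtain ⟨R, hR⟩ := hKc.isBounded.exists_norm_le
  have h1 := hR _ (interior_subset (hsub ⟨|R| + ‖z‖ + 1, by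
    simp only [Set.mem_Ici]; positivity, rfl⟩))
  simp only at h1
  have h2 : ‖(|R| + ‖z‖ + 1) • v‖ = |R| + ‖z‖ + 1 := by
    rw [norm_smul, hv, mul_one, Real.norm_of_nonneg (by positivity)]
  have h3 := norm_sub_le (z + (|R| + ‖z‖ + 1) • v) z
  rw [add_sub_cancel_left, h2] at h3
  linarith [le_abs_self R]

lemma ray_unique {K : Set Pl} (hKc : IsCompact K) (hKv : Convex ℝ K) {z v : Pl}
    (hz : z ∈ interior K) {a b : ℝ}
    (ha : z + a • v ∈ frontier K) (hb : z + b • v ∈ frontier K) (hab : 0 < a * b) : a = b := by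
  have key : ∀ a b : ℝ, z + a • v ∈ frontier K → z + b • v ∈ frontier K → 0 < a * b →
      |a| < |b| → False := by
    intro a b ha hb hab hlt
    apply ha.2
    have hb0 : b ≠ 0 := by rintro rfl; simp at hab
    have hpos : 0 < a / b := by
      rw [show a / b = a * b / b ^ 2 by field_simp]; positivity
    have hlt1 : a / b < 1 := by
      have : |a / b| < 1 := by rw [abs_div, div_lt_one (abs_pos.2 hb0)]; exact hlt
      exact (le_abs_self _).trans_lt this
    apply hKv.openSegment_interior_self_subset_interior hz (hKc.isClosed.frontier_subset hb)
    refine ⟨1 - a / b, a / b, by linarith, hpos, by ring, ?_⟩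
    rw [smul_add, smul_smul, div_mul_cancel₀ _ hb0]
    module
  rcases lt_trichotomy |a| |b| with h | h | h
  · exact (key a b ha hb hab h).elim
  · rcases abs_eq_abs.1 h with h | h
    · exact h
    · rw [h] at hab; nlinarith [sq_nonneg b]
  · exact (key b a hb ha (by linarith) h).elim

/-- unit vector orthogonal to `dir θ` -/
noncomputable def perp (θ : ℝ) : Pl := dir (θ + Real.pi / 2)

lemma norm_perp (θ : ℝ) : ‖perp θ‖ = 1 := norm_dir _

lemma inner_perp (θ : ℝ) : ⟪perp θ, dir θ⟫ = 0 := by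
  rw [perp, inner_coord]
  simp only [dir_zero, dir_one, Real.cos_add_pi_div_two, Real.sin_add_pi_div_two]
  ring

lemma exists_perp {w : Pl} {θ : ℝ} (hw : ⟪w, dir θ⟫ = 0) : ∃ a : ℝ, w = a • perp θ := by
  refine ⟨-w 0 * Real.sin θ + w 1 * Real.cos θ, ?_⟩
  rw [inner_coord, dir_zero, dir_one] at hw
  ext i
  fin_cases i
  · simp only [perp, PiLp.smul_apply, smul_eq_mul, Fin.zero_eta, dir_zero, Real.cos_add_pi_div_two]
    linear_combination (-w 0) * Real.sin_sq_add_cos_sq θ + Real.cos θ * hw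
  · simp only [perp, PiLp.smul_apply, smul_eq_mul, Fin.mk_one, dir_one, Real.sin_add_pi_div_two]
    linear_combination (-w 1) * Real.sin_sq_add_cos_sq θ + Real.sin θ * hw

/-- Generic lines meet the frontier in at least two points. -/
lemma two_points {K : Set Pl} (hKc : IsCompact K) {θ : ℝ} {z : Pl} (hz : z ∈ interior K) :
    ∃ x ∈ frontier K, ∃ y ∈ frontier K, x ≠ y ∧ ⟪x, dir θ⟫ = ⟪z, dir θ⟫ ∧
      ⟪y, dir θ⟫ = ⟪z, dir θ⟫ := by
  obtain ⟨s, hs, h1⟩ := exists_ray hKc hz (norm_perp θ)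
  obtain ⟨r, hr, h2⟩ := exists_ray hKc (v := -perp θ) hz (by rw [norm_neg, norm_perp])
  refine ⟨_, h1, _, h2, ?_, ?_, ?_⟩
  · intro h
    rw [smul_neg, ← neg_smul] at h
    have h3 : (s + r) • perp θ = 0 := by
      have := add_left_cancel h
      rw [add_smul, this]; module
    have h4 : perp θ ≠ 0 := by
      intro h; have := norm_perp θ; rw [h] at this; simp at this
    rcases smul_eq_zero.1 h3 with h5 | h5
    · linarith
    · exact h4 h5
  · rw [inner_add_left, real_inner_smul_left, inner_perp]; ring
  · rw [inner_add_left, real_inner_smul_left, inner_neg_left, inner_perp]; ring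

/-- Generic lines meet the frontier in at most two points. -/
lemma not_three_points {K : Set Pl} (hKc : IsCompact K) (hKv : Convex ℝ K) {θ : ℝ} {z : Pl}
    (hz : z ∈ interior K) {x y w : Pl} (hx : x ∈ frontier K) (hy : y ∈ frontier K)
    (hw : w ∈ frontier K) (hxt : ⟪x, dir θ⟫ = ⟪z, dir θ⟫) (hyt : ⟪y, dir θ⟫ = ⟪z, dir θ⟫)
    (hwt : ⟪w, dir θ⟫ = ⟪z, dir θ⟫) : x = y ∨ x = w ∨ y = w := by
  have key : ∀ x ∈ frontier K, ⟪x, dir θ⟫ = ⟪z, dir θ⟫ → ∃ a : ℝ, a ≠ 0 ∧ x = z + a • perp θ := by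
    intro x hx hxt
    obtain ⟨a, ha⟩ := exists_perp (w := x - z) (θ := θ) (by rw [inner_sub_left, hxt, sub_self])
    refine ⟨a, ?_, by rw [← ha]; abel⟩
    rintro rfl
    rw [zero_smul, sub_eq_zero] at ha
    rw [ha] at hx
    exact hx.2 hz
  obtain ⟨a, ha, rfl⟩ := key x hx hxt
  obtain ⟨b, hb, rfl⟩ := key y hy hyt
  obtain ⟨c, hc, rfl⟩ := key w hw hwt
  by_cases hab : 0 < a * b
  · left; rw [ray_unique hKc hKv hz hx hy hab]
  by_cases hac : 0 < a * c
  · right; left; rw [ray_unique hKc hKv hz hx hw hac]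
  right; right
  have hbc : 0 < b * c := by
    have h1 : a * b < 0 := lt_of_le_of_ne (not_lt.1 hab) (mul_ne_zero ha hb)
    have h2 : a * c < 0 := lt_of_le_of_ne (not_lt.1 hac) (mul_ne_zero ha hc)
    have h3 := mul_pos_of_neg_of_neg h1 h2
    have h4 : a * b * (a * c) = a ^ 2 * (b * c) := by ring
    rw [h4] at h3
    exact pos_of_mul_pos_right h3 (sq_nonneg a)
  rw [ray_unique hKc hKv hz hy hw hbc]

/-- frontier points with a normal direction of angle in `[a,b]` -/
def normalPiece (K : Set Pl) (a b : ℝ) : Set Pl :=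
  {x | x ∈ frontier K ∧ ∃ θ ∈ Set.Icc a b, ∀ y ∈ K, ⟪y - x, dir θ⟫ ≤ 0}

lemma isCompact_normalPiece {K : Set Pl} (hKc : IsCompact K) (a b : ℝ) :
    IsCompact (normalPiece K a b) := by
  have hF : IsCompact (frontier K) := hKc.of_isClosed_subset isClosed_frontier
    hKc.isClosed.frontier_subset
  have hclosed : IsClosed {p : Pl × ℝ | ∀ y ∈ K, ⟪y - p.1, dir p.2⟫ ≤ 0} := by
    simp only [Set.ofPred_forall]
    refine isClosed_iInter fun y => isClosed_iInter fun _ => ?_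
    refine isClosed_le ?_ continuous_const
    have := continuous_dir
    fun_prop
  have hc := ((hF.prod (isCompact_Icc (a := a) (b := b))).inter_right hclosed).image continuous_fst
  convert hc using 1
  ext x
  constructor
  · rintro ⟨hx, θ, hθ, h⟩
    exact ⟨(x, θ), ⟨⟨hx, hθ⟩, h⟩, rfl⟩
  · rintro ⟨⟨x', θ⟩, ⟨⟨hx, hθ⟩, h⟩, rfl⟩
    exact ⟨hx, θ, hθ, h⟩

lemma normalPiece_near {K : Set Pl} (hKc : IsCompact K) {a δ : ℝ} {x y : Pl}
    (hx : x ∈ normalPiece K a (a + δ)) (hy : y ∈ normalPiece K a (a + δ)) :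
    |⟪x - y, dir a⟫| ≤ 2 * δ * ‖x - y‖ := by
  have key : ∀ x ∈ normalPiece K a (a + δ), ∀ y ∈ normalPiece K a (a + δ),
      ⟪x - y, dir a⟫ ≤ 2 * δ * ‖x - y‖ := by
    rintro x ⟨hx, -⟩ y ⟨hy, θ, hθ, h⟩
    have h1 := h x (hKc.isClosed.frontier_subset hx)
    have h2 : ⟪x - y, dir a⟫ = ⟪x - y, dir θ⟫ + ⟪x - y, dir a - dir θ⟫ := by
      rw [inner_sub_right]; ring
    have h3 := real_inner_le_norm (x - y) (dir a - dir θ)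
    have h4 := norm_dir_sub a θ
    have h5 : |a - θ| ≤ δ := abs_le.2 ⟨by linarith [hθ.2], by linarith [hθ.1, hθ.2]⟩
    have h6 := norm_nonneg (x - y)
    nlinarith
  rw [abs_le]
  refine ⟨?_, key x hx y hy⟩
  have := key y hy x hx
  rw [← neg_sub x y, inner_neg_left, norm_neg] at this
  linarith

lemma breadth_nonneg {K : Set Pl} (hK : K.Nonempty) (hKc : IsCompact K) (u : Pl) :
    0 ≤ suppFn K u - -suppFn K (-u) := by
  obtain ⟨x, hx⟩ := hK
  have h1 := (suppFn_max ⟨x, hx⟩ hKc u).2 x hx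
  have h2 := (suppFn_max ⟨x, hx⟩ hKc (-u)).2 x hx
  rw [inner_neg_right] at h2
  linarith

section slice

variable {K : Set Pl} {S : Finset ℕ} {P : ℕ → Set Pl} {φ : ℕ → ℝ} {η : ℝ}

lemma piece_finite (hKc : IsCompact K) (hη' : η < 1 / 2) {Q : Set Pl} (hQ : Q ⊆ K) {ψ : ℝ}
    (hnear : ∀ x ∈ Q, ∀ y ∈ Q, |⟪x - y, dir ψ⟫| ≤ η * ‖x - y‖) : μH[1] Q ≠ ⊤ := by
  have h1 : ENNReal.ofReal (1 - 2 * η) * μH[1] Q ≤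
      volume ((fun x : Pl => ⟪x, dir (ψ + Real.pi / 2)⟫) '' Q) := by
    apply le_volume_image (by linarith)
    intro x hx y hy
    have := (inner_bounds (hnear x hx y hy) (ψ + Real.pi / 2)).2
    rw [add_sub_cancel_left, Real.sin_pi_div_two, abs_one, inner_sub_left] at this
    exact this
  have h2 : volume ((fun x : Pl => ⟪x, dir (ψ + Real.pi / 2)⟫) '' Q) < ⊤ := by
    refine (measure_mono (Set.image_mono hQ)).trans_lt ?_
    exact (hKc.image (by fun_prop)).measure_lt_top
  intro htop
  rw [htop, ENNReal.mul_top (by simp; linarith)] at h1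
  exact absurd (h1.trans_lt h2) (lt_irrefl _)

lemma slice_upper (hK : K.Nonempty) (hKc : IsCompact K) (hKv : Convex ℝ K)
    (hKi : (interior K).Nonempty) (hη : 0 < η)
    (hdisj : ∀ i j, i ≠ j → Disjoint (P i) (P j)) (hmeas : ∀ i, MeasurableSet (P i))
    (hsub : ∀ i, P i ⊆ frontier K)
    (hnear : ∀ i, ∀ x ∈ P i, ∀ y ∈ P i, |⟪x - y, dir (φ i)⟫| ≤ η * ‖x - y‖)
    (hfin : ∀ i, μH[1] (P i) ≠ ⊤) (θ : ℝ) :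
    ∑ i ∈ S, (|Real.sin (θ - φ i)| - 2 * η) * (μH[1] (P i)).toReal ≤
      2 * breadth K (dir θ) := by
  classical
  set f : Pl → ℝ := fun x => ⟪x, dir θ⟫ with hf
  set α := -suppFn K (-dir θ) with hα
  set β := suppFn K (dir θ) with hβ
  have hb : breadth K (dir θ) = β - α := by rw [breadth, hα, hβ]; ring
  have hb0 : 0 ≤ β - α := breadth_nonneg hK hKc (dir θ)
  have hfcont : Continuous f := by rw [hf]; fun_prop
  set G := S.filter (fun i => 2 * η < |Real.sin (θ - φ i)|) with hG
  have hlow : ∀ i ∈ G, ∀ x ∈ P i, ∀ y ∈ P i,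
      (|Real.sin (θ - φ i)| - 2 * η) * ‖x - y‖ ≤ |f x - f y| := by
    intro i _ x hx y hy
    have := (inner_bounds (hnear i x hx y hy) θ).2
    rwa [inner_sub_left] at this
  have hpos : ∀ i ∈ G, 0 < |Real.sin (θ - φ i)| - 2 * η := by
    intro i hi
    have := (Finset.mem_filter.1 hi).2
    linarith
  have hmi : ∀ i ∈ G, MeasurableSet (f '' P i) := by
    intro i hi
    apply (hmeas i).image_of_continuousOn_injOn hfcont.continuousOn
    intro x hx y hy hxy
    have h1 := hlow i hi x hx y hy
    rw [hxy, sub_self, abs_zero] at h1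
    have h2 : ‖x - y‖ ≤ 0 := by
      by_contra hc
      push Not at hc
      nlinarith [mul_pos (hpos i hi) hc]
    exact sub_eq_zero.1 (norm_le_zero_iff.1 h2)
  have hfK : ∀ i, ∀ x ∈ P i, α ≤ f x ∧ f x ≤ β := by
    intro i x hx
    have hxK := hKc.isClosed.frontier_subset (hsub i hx)
    have h1 := (suppFn_max hK hKc (dir θ)).2 x hxK
    have h2 := (suppFn_max hK hKc (-dir θ)).2 x hxK
    rw [inner_neg_right] at h2
    exact ⟨by rw [hα]; simp only [hf]; linarith, h1⟩
  have hcount : ∀ᵐ t : ℝ, ∑ i ∈ G, (f '' P i).indicator (1 : ℝ → ENNReal) t ≤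
      (Set.Ioo α β).indicator (fun _ => 2) t := by
    have hae : ∀ᵐ t : ℝ, t ∉ ({α, β} : Set ℝ) :=
      measure_eq_zero_iff_ae_notMem.1 (Set.Finite.measure_zero (Set.toFinite _) _)
    filter_upwards [hae] with t ht
    simp only [Set.mem_insert_iff, Set.mem_singleton_iff, not_or] at ht
    have hsum : ∑ i ∈ G, (f '' P i).indicator (1 : ℝ → ENNReal) t =
        ((G.filter (fun i => t ∈ f '' P i)).card : ENNReal) := by
      rw [Finset.card_filter]
      push_cast
      apply Finset.sum_congr rfl
      intro i _
      simp only [Set.indicator_apply, Pi.one_apply]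
    by_cases hI : t ∈ Set.Ioo α β
    · rw [Set.indicator_of_mem hI, hsum]
      have hcard : (G.filter (fun i => t ∈ f '' P i)).card ≤ 2 := by
        by_contra hc
        push Not at hc
        obtain ⟨i, j, k, hi, hj, hk, hij, hik, hjk⟩ := Finset.two_lt_card_iff.1 hc
        obtain ⟨x, hx, hxt⟩ := (Finset.mem_filter.1 hi).2
        obtain ⟨y, hy, hyt⟩ := (Finset.mem_filter.1 hj).2
        obtain ⟨w, hw, hwt⟩ := (Finset.mem_filter.1 hk).2
        obtain ⟨z, hz, hzt⟩ := exists_interior_level hK hKc hKv hKi (dir θ) hI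
        rcases not_three_points hKc hKv hz (hsub i hx) (hsub j hy) (hsub k hw)
          (hxt.trans hzt.symm) (hyt.trans hzt.symm) (hwt.trans hzt.symm) with h | h | h
        · exact Set.disjoint_left.1 (hdisj i j hij) hx (h ▸ hy)
        · exact Set.disjoint_left.1 (hdisj i k hik) hx (h ▸ hw)
        · exact Set.disjoint_left.1 (hdisj j k hjk) hy (h ▸ hw)
      exact_mod_cast hcard
    · rw [hsum]
      have : G.filter (fun i => t ∈ f '' P i) = ∅ := by
        apply Finset.filter_eq_empty_iff.2
        rintro i _ ⟨x, hx, hxt⟩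
        have h3 := hfK i x hx
        rw [hxt] at h3
        exact hI ⟨lt_of_le_of_ne h3.1 (Ne.symm ht.1), lt_of_le_of_ne h3.2 ht.2⟩
      rw [this]; simp
  have hmain : ∑ i ∈ G, ENNReal.ofReal (|Real.sin (θ - φ i)| - 2 * η) * μH[1] (P i) ≤
      ENNReal.ofReal (2 * (β - α)) := by
    calc ∑ i ∈ G, ENNReal.ofReal (|Real.sin (θ - φ i)| - 2 * η) * μH[1] (P i)
        ≤ ∑ i ∈ G, volume (f '' P i) :=
          Finset.sum_le_sum fun i hi => le_volume_image (hpos i hi) (hlow i hi)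
      _ = ∑ i ∈ G, ∫⁻ t, (f '' P i).indicator (1 : ℝ → ENNReal) t := by
          apply Finset.sum_congr rfl
          intro i hi
          rw [lintegral_indicator_one (hmi i hi)]
      _ = ∫⁻ t, ∑ i ∈ G, (f '' P i).indicator (1 : ℝ → ENNReal) t := by
          rw [lintegral_finsetSum' _ fun i hi =>
            (measurable_one.indicator (hmi i hi)).aemeasurable]
      _ ≤ ∫⁻ t, (Set.Ioo α β).indicator (fun _ => 2) t := lintegral_mono_ae hcount
      _ = ENNReal.ofReal (2 * (β - α)) := by
          rw [lintegral_indicator_const measurableSet_Ioo, Real.volume_Ioo,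
            ENNReal.ofReal_mul (by norm_num)]
          simp
  have hreal : ∑ i ∈ G, (|Real.sin (θ - φ i)| - 2 * η) * (μH[1] (P i)).toReal ≤ 2 * (β - α) := by
    rw [← ENNReal.ofReal_le_ofReal_iff (by linarith), ENNReal.ofReal_sum_of_nonneg]
    · refine le_trans (le_of_eq ?_) hmain
      apply Finset.sum_congr rfl
      intro i hi
      rw [ENNReal.ofReal_mul (hpos i hi).le, ENNReal.ofReal_toReal (hfin i)]
    · intro i hi
      exact mul_nonneg (hpos i hi).le ENNReal.toReal_nonneg
  rw [hb]
  refine le_trans ?_ hreal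
  rw [hG, Finset.sum_filter]
  apply Finset.sum_le_sum
  intro i _
  split_ifs with h
  · exact le_rfl
  · exact mul_nonpos_of_nonpos_of_nonneg (by linarith) ENNReal.toReal_nonneg

lemma slice_lower (hK : K.Nonempty) (hKc : IsCompact K) (hKv : Convex ℝ K)
    (hKi : (interior K).Nonempty) (hη : 0 < η)
    (hcov : ∀ x ∈ frontier K, ∃ i ∈ S, x ∈ P i)
    (hnear : ∀ i, ∀ x ∈ P i, ∀ y ∈ P i, |⟪x - y, dir (φ i)⟫| ≤ η * ‖x - y‖)
    (hfin : ∀ i, μH[1] (P i) ≠ ⊤) (θ : ℝ) :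
    2 * breadth K (dir θ) ≤
      ∑ i ∈ S, (|Real.sin (θ - φ i)| + 4 * η) * (μH[1] (P i)).toReal := by
  classical
  set f : Pl → ℝ := fun x => ⟪x, dir θ⟫ with hf
  set α := -suppFn K (-dir θ) with hα
  set β := suppFn K (dir θ) with hβ
  have hb : breadth K (dir θ) = β - α := by rw [breadth, hα, hβ]; ring
  set a : ℕ → ℝ := fun i => if 2 * η < |Real.sin (θ - φ i)| then 1 else 2 with ha
  have ha1 : ∀ i, 1 ≤ a i := by
    intro i; simp only [ha]; split_ifs <;> norm_num
  have ha1' : ∀ i, (1 : ENNReal) ≤ ENNReal.ofReal (a i) := by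
    intro i; rw [ENNReal.one_le_ofReal]; exact ha1 i
  have hcount : ∀ t : ℝ, (Set.Ioo α β).indicator (fun _ => (2 : ENNReal)) t ≤
      ∑ i ∈ S, (toMeasurable volume (f '' P i)).indicator (fun _ => ENNReal.ofReal (a i)) t := by
    intro t
    by_cases hI : t ∈ Set.Ioo α β
    swap
    · rw [Set.indicator_of_notMem hI]; exact zero_le
    rw [Set.indicator_of_mem hI]
    obtain ⟨z, hz, hzt⟩ := exists_interior_level hK hKc hKv hKi (dir θ) hI
    obtain ⟨x, hx, y, hy, hxy, hxt, hyt⟩ := two_points (θ := θ) hKc hz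
    rw [hzt] at hxt hyt
    obtain ⟨i, hi, hxi⟩ := hcov x hx
    obtain ⟨j, hj, hyj⟩ := hcov y hy
    have hti : t ∈ toMeasurable volume (f '' P i) := subset_toMeasurable _ _ ⟨x, hxi, hxt⟩
    have htj : t ∈ toMeasurable volume (f '' P j) := subset_toMeasurable _ _ ⟨y, hyj, hyt⟩
    by_cases hij : i = j
    · subst hij
      have hbad : ¬ (2 * η < |Real.sin (θ - φ i)|) := by
        intro hlt
        have h1 := (inner_bounds (hnear i x hxi y hyj) θ).2
        rw [inner_sub_left, hxt, hyt, sub_self, abs_zero] at h1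
        have h2 : 0 < ‖x - y‖ := norm_pos_iff.2 (sub_ne_zero.2 hxy)
        nlinarith [mul_pos (sub_pos.2 hlt) h2]
      have hai : a i = 2 := by simp only [ha]; rw [if_neg hbad]
      refine le_trans ?_ (Finset.single_le_sum (fun k _ => zero_le) hi)
      rw [Set.indicator_of_mem hti, hai]
      simp
    · have hs : ({i, j} : Finset ℕ) ⊆ S := by
        intro k hk
        simp only [Finset.mem_insert, Finset.mem_singleton] at hk
        rcases hk with rfl | rfl <;> assumption
      refine le_trans ?_ (Finset.sum_le_sum_of_subset hs)
      rw [Finset.sum_pair hij, Set.indicator_of_mem hti, Set.indicator_of_mem htj]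
      calc (2 : ENNReal) = 1 + 1 := by norm_num
        _ ≤ _ := add_le_add (ha1' i) (ha1' j)
  have hmain : ENNReal.ofReal (2 * (β - α)) ≤
      ∑ i ∈ S, ENNReal.ofReal (a i) *
        (ENNReal.ofReal (|Real.sin (θ - φ i)| + η) * μH[1] (P i)) := by
    calc ENNReal.ofReal (2 * (β - α)) = ∫⁻ t, (Set.Ioo α β).indicator (fun _ => 2) t := by
          rw [lintegral_indicator_const measurableSet_Ioo, Real.volume_Ioo,
            ENNReal.ofReal_mul (by norm_num)]
          simp
      _ ≤ ∫⁻ t, ∑ i ∈ S,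
          (toMeasurable volume (f '' P i)).indicator (fun _ => ENNReal.ofReal (a i)) t :=
          lintegral_mono hcount
      _ = ∑ i ∈ S, ∫⁻ t,
          (toMeasurable volume (f '' P i)).indicator (fun _ => ENNReal.ofReal (a i)) t := by
          rw [lintegral_finsetSum' _ fun i hi =>
            (measurable_const.indicator (measurableSet_toMeasurable _ _)).aemeasurable]
      _ = ∑ i ∈ S, ENNReal.ofReal (a i) * volume (f '' P i) := by
          apply Finset.sum_congr rfl
          intro i _
          rw [lintegral_indicator_const (measurableSet_toMeasurable _ _), measure_toMeasurable]
      _ ≤ _ := by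
          apply Finset.sum_le_sum
          intro i _
          gcongr
          apply volume_image_le (by positivity)
          intro x hx y hy
          have := (inner_bounds (hnear i x hx y hy) θ).1
          rwa [inner_sub_left] at this
  have hreal : 2 * (β - α) ≤
      ∑ i ∈ S, a i * ((|Real.sin (θ - φ i)| + η) * (μH[1] (P i)).toReal) := by
    have hnn : ∀ i ∈ S, 0 ≤ a i * ((|Real.sin (θ - φ i)| + η) * (μH[1] (P i)).toReal) := by
      intro i _
      have := ha1 i
      have h2 : 0 ≤ (μH[1] (P i)).toReal := ENNReal.toReal_nonneg
      positivity
    rw [← ENNReal.ofReal_le_ofReal_iff (Finset.sum_nonneg hnn), ENNReal.ofReal_sum_of_nonneg hnn]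
    refine hmain.trans (le_of_eq ?_)
    apply Finset.sum_congr rfl
    intro i _
    rw [ENNReal.ofReal_mul (by linarith [ha1 i]), ENNReal.ofReal_mul (by positivity),
      ENNReal.ofReal_toReal (hfin i)]
  rw [hb]
  refine hreal.trans ?_
  apply Finset.sum_le_sum
  intro i _
  rw [← mul_assoc]
  apply mul_le_mul_of_nonneg_right _ ENNReal.toReal_nonneg
  simp only [ha]
  split_ifs with h
  · linarith
  · linarith

end slice

lemma continuous_breadth {K : Set Pl} (hKc : IsCompact K) :
    Continuous (fun θ => breadth K (dir θ)) := by
  have h : Continuous (suppFn K) := by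
    unfold suppFn
    apply hKc.continuous_sSup (f := fun (u : Pl) (x : Pl) => ⟪x, u⟫)
    change Continuous (fun p : Pl × Pl => ⟪p.2, p.1⟫)
    fun_prop
  unfold breadth
  exact (h.comp continuous_dir).add (h.comp continuous_dir.neg)

lemma cauchy_approx {K : Set Pl} (hK : K.Nonempty) (hKc : IsCompact K) (hKv : Convex ℝ K)
    (hKi : (interior K).Nonempty) {δ : ℝ} (hδ : 0 < δ) (hδ' : δ < 1 / 4) :
    |2 * (∫ θ in (0:ℝ)..(2 * Real.pi), breadth K (dir θ)) - 4 * (μH[1] (frontier K)).toReal| ≤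
      δ * (16 * Real.pi * (μH[1] (frontier K)).toReal) := by
  set A : ℕ → Set Pl := fun i => normalPiece K (i * δ) (i * δ + δ) with hA
  set P := disjointed A with hP
  set φ : ℕ → ℝ := fun i => i * δ with hφ
  set η := 2 * δ with hη
  have hPA : ∀ i, P i ⊆ A i := fun i => disjointed_subset A i
  have hsub : ∀ i, P i ⊆ frontier K := fun i x hx => (hPA i hx).1
  have hmeas : ∀ i, MeasurableSet (P i) := fun i =>
    MeasurableSet.disjointed (fun j => (isCompact_normalPiece hKc _ _).isClosed.measurableSet) i
  have hdisj : ∀ i j, i ≠ j → Disjoint (P i) (P j) := fun i j hij => disjoint_disjointed A hij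
  have hnear : ∀ i, ∀ x ∈ P i, ∀ y ∈ P i, |⟪x - y, dir (φ i)⟫| ≤ η * ‖x - y‖ :=
    fun i x hx y hy => normalPiece_near hKc (hPA i hx) (hPA i hy)
  have hfin : ∀ i, μH[1] (P i) ≠ ⊤ := fun i =>
    piece_finite hKc (by linarith) ((hsub i).trans hKc.isClosed.frontier_subset) (hnear i)
  set N := ⌊2 * Real.pi / δ⌋₊ with hN
  set S := Finset.range (N + 1) with hS
  have hcov : ∀ x ∈ frontier K, ∃ i ∈ S, x ∈ P i := by
    intro x hx
    obtain ⟨θ, hθ, h⟩ := exists_normal hKv hKi hx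
    have h0 : 0 ≤ θ / δ := div_nonneg hθ.1 hδ.le
    have hxA : x ∈ ⋃ i ∈ Finset.range (N + 1), A i := by
      refine Set.mem_biUnion (x := ⌊θ / δ⌋₊) ?_ ?_
      · simp only [Finset.coe_range, Set.mem_Iio, Nat.lt_succ_iff]
        exact Nat.floor_le_floor (by gcongr; exact hθ.2)
      · refine ⟨hx, θ, ⟨?_, ?_⟩, h⟩
        · rw [← le_div_iff₀ hδ]; exact Nat.floor_le h0
        · have := (Nat.lt_floor_add_one (θ / δ)).le
          rw [div_le_iff₀ hδ] at this
          linarith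
    have hxP : x ∈ ⋃ i ∈ Finset.range (N + 1), P i := by
      rw [hP, biUnion_range_succ_disjointed, partialSups_eq_biSup]
      simp only [Set.iSup_eq_iUnion, Set.mem_iUnion, Finset.mem_range, Nat.lt_succ_iff] at hxA ⊢
      exact hxA
    simpa [hS] using hxP
  have hM : (μH[1] (frontier K)).toReal = ∑ i ∈ S, (μH[1] (P i)).toReal := by
    have : frontier K = ⋃ i ∈ S, P i := by
      apply Set.Subset.antisymm
      · intro x hx
        simpa using hcov x hx
      · exact Set.iUnion₂_subset fun i _ => hsub i
    rw [this, measure_biUnion_finset (fun i _ j _ hij => hdisj i j hij) (fun i _ => hmeas i),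
      ENNReal.toReal_sum fun i _ => hfin i]
  set M := (μH[1] (frontier K)).toReal with hMdef
  have hcs : ∀ i, Continuous fun θ : ℝ => |Real.sin (θ - φ i)| * (μH[1] (P i)).toReal := by
    intro i; fun_prop
  have hintg : ∫ θ in (0:ℝ)..(2 * Real.pi),
      ∑ i ∈ S, |Real.sin (θ - φ i)| * (μH[1] (P i)).toReal = 4 * M := by
    rw [intervalIntegral.integral_finsetSum fun i _ => (hcs i).intervalIntegrable _ _, hM,
      Finset.mul_sum]
    apply Finset.sum_congr rfl
    intro i _
    rw [intervalIntegral.integral_mul_const, integral_abs_sin]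
  have hup := fun θ => slice_upper (S := S) hK hKc hKv hKi (by positivity) hdisj hmeas hsub hnear hfin θ
  have hlo := fun θ => slice_lower (S := S) hK hKc hKv hKi (by positivity) hcov hnear hfin θ
  have hbc := continuous_breadth hKc
  have hsc : Continuous fun θ : ℝ => ∑ i ∈ S, |Real.sin (θ - φ i)| * (μH[1] (P i)).toReal :=
    continuous_finsetSum _ fun i _ => hcs i
  have hpi := Real.pi_pos
  have hM0 : 0 ≤ M := ENNReal.toReal_nonneg
  have hbound : ∀ θ, ‖2 * breadth K (dir θ) -
      ∑ i ∈ S, |Real.sin (θ - φ i)| * (μH[1] (P i)).toReal‖ ≤ 4 * η * M := by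
    intro θ
    have h1 := hup θ
    have h2 := hlo θ
    simp only [sub_mul, add_mul, Finset.sum_sub_distrib, Finset.sum_add_distrib,
      ← Finset.mul_sum, ← hM] at h1 h2
    have h3 : 0 ≤ η * M := by positivity
    rw [Real.norm_eq_abs, abs_le]
    constructor <;> linarith
  have hfinal := intervalIntegral.norm_integral_le_of_norm_le_const (a := 0) (b := 2 * Real.pi)
    (fun θ _ => hbound θ)
  rw [intervalIntegral.integral_sub ((hbc.const_mul 2).intervalIntegrable _ _)
    (hsc.intervalIntegrable _ _), hintg, intervalIntegral.integral_const_mul, Real.norm_eq_abs,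
    sub_zero, abs_of_pos (by positivity : (0:ℝ) < 2 * Real.pi)] at hfinal
  refine hfinal.trans (le_of_eq ?_)
  rw [hη]; ring

/-- Cauchy's formula: the integral of the breadth over all directions is twice
the perimeter of a plane convex body. -/
theorem stmt_9 {K : Set (EuclideanSpace ℝ (Fin 2))}
    (hK : K.Nonempty) (hKc : IsCompact K) (hKv : Convex ℝ K)
    (hKi : (interior K).Nonempty) :
    ∫ θ in (0:ℝ)..(2 * Real.pi), breadth K (dir θ) =
      2 * (μH[1] (frontier K)).toReal := by
  set M := (μH[1] (frontier K)).toReal with hM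
  have hM0 : 0 ≤ M := ENNReal.toReal_nonneg
  set D := |2 * (∫ θ in (0:ℝ)..(2 * Real.pi), breadth K (dir θ)) - 4 * M| with hD
  set C := 16 * Real.pi * M with hC
  have hC0 : 0 ≤ C := by have := Real.pi_pos; positivity
  have hD0 : D ≤ 0 := by
    by_contra hc
    push Not at hc
    set δ := min (1 / 8) (D / (2 * (C + 1))) with hδ
    have hδ0 : 0 < δ := by rw [hδ]; apply lt_min <;> positivity
    have h1 : δ < 1 / 4 := (min_le_left _ _).trans_lt (by norm_num)
    have h2 := cauchy_approx hK hKc hKv hKi hδ0 h1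
    have h3 : δ ≤ D / (2 * (C + 1)) := min_le_right _ _
    rw [le_div_iff₀ (by positivity)] at h3
    have h4 : D ≤ δ * C := h2
    nlinarith
  have := abs_eq_zero.1 (le_antisymm hD0 (abs_nonneg _))
  linarith
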